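/- arXiv:1701.01181 — 16 statements merged into one kernel-verified Lean document; each statement's English description precedes it below -/
import Mathlib

section
/- Let X be a set, M ⊆ P'(X) and O be a topology on M. Then: (i) T_O is the supremum of the topologies T_{+O} and T_{-O} on X; (ii) O_u is a Tychonoff-type topology on M; (iii) O_l is a lower-Vietoris-type topology on M; and (iv) O is a Vietoris-type topology on M if and only if O is the supremum of O_u and O_l. -/
open Set TopologicalSpace Topology Cardinal

universe u

variable {X : Type u}

/-- `A⁺_M = {F ∈ M : F ⊆ A}`. -/
def hyperPlus (M : Set (Set X)) (A : Set X) : Set M :=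
  {F | (F : Set X) ⊆ A}

/-- `A⁻_M = {F ∈ M : F ∩ A ≠ ∅}`. -/
def hyperMinus (M : Set (Set X)) (A : Set X) : Set M :=
  {F | ((F : Set X) ∩ A).Nonempty}

/-- `B_O = {A ⊆ X : A⁺_M ∈ O}`. -/
def BOfam (M : Set (Set X)) (O : TopologicalSpace M) : Set (Set X) :=
  {A | IsOpen[O] (hyperPlus M A)}

/-- `P_O = {A ⊆ X : A⁻_M ∈ O}`. -/
def POfam (M : Set (Set X)) (O : TopologicalSpace M) : Set (Set X) :=
  {A | IsOpen[O] (hyperMinus M A)}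

/-- `T₊O`: the topology on `X` with base `B_O`. -/
def TplusO (M : Set (Set X)) (O : TopologicalSpace M) : TopologicalSpace X :=
  generateFrom (BOfam M O)

/-- `T₋O`: the topology on `X` with subbase `P_O`. -/
def TminusO (M : Set (Set X)) (O : TopologicalSpace M) : TopologicalSpace X :=
  generateFrom (POfam M O)

/-- `T_O`: the topology on `X` with subbase `B_O ∪ P_O`. -/
def TofO (M : Set (Set X)) (O : TopologicalSpace M) : TopologicalSpace X :=
  generateFrom (BOfam M O ∪ POfam M O)

/-- `O_u`: the topology on `M` with base `(B_O)⁺_M`. -/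
def Ou (M : Set (Set X)) (O : TopologicalSpace M) : TopologicalSpace M :=
  generateFrom (hyperPlus M '' BOfam M O)

/-- `O_l`: the topology on `M` with subbase `(P_O)⁻_M`. -/
def Ol (M : Set (Set X)) (O : TopologicalSpace M) : TopologicalSpace M :=
  generateFrom (hyperMinus M '' POfam M O)

/-- `O` is a Vietoris-type topology on `M`. -/
def IsVietorisType (M : Set (Set X)) (O : TopologicalSpace M) : Prop :=
  O = generateFrom (hyperPlus M '' BOfam M O ∪ hyperMinus M '' POfam M O)

/-- `O` is a strong Vietoris-type topology on `M`. -/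
def IsStrongVietorisType (M : Set (Set X)) (O : TopologicalSpace M) : Prop :=
  IsVietorisType M O ∧ TplusO M O = TminusO M O

/-- `O` is a Tychonoff-type topology on `M`: `O ∩ {A⁺_M : A ⊆ X}` is a base for `O`. -/
def IsTychonoffType (M : Set (Set X)) (O : TopologicalSpace M) : Prop :=
  @IsTopologicalBasis M O {S | IsOpen[O] S ∧ ∃ A : Set X, S = hyperPlus M A}

/-- `O` is a lower-Vietoris-type topology on `M`:
`O ∩ {A⁻_M : A ⊆ X}` is a subbase for `O`. -/
def IsLowerVietorisType (M : Set (Set X)) (O : TopologicalSpace M) : Prop :=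
  O = generateFrom {S | IsOpen[O] S ∧ ∃ A : Set X, S = hyperMinus M A}

/-- `T_O = T₊O ∨ T₋O` (the supremum, i.e. the coarsest topology finer than
both, which in Mathlib's order on topologies is `⊓`), `O_u` is a Tychonoff-type topology
on `M`, `O_l` is a lower-Vietoris-type topology on `M`, and `O` is a Vietoris-type
topology on `M` iff `O` is the supremum of `O_u` and `O_l`. -/
theorem statement0 (M : Set (Set X)) (hM : ∀ A ∈ M, A.Nonempty) (O : TopologicalSpace M) :
    TofO M O = TplusO M O ⊓ TminusO M O ∧
    IsTychonoffType M (Ou M O) ∧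
    IsLowerVietorisType M (Ol M O) ∧
    (IsVietorisType M O ↔ O = Ou M O ⊓ Ol M O) := by
  have key : ∀ {Y : Type u} (S T : Set (Set Y)),
      generateFrom (S ∪ T) = generateFrom S ⊓ generateFrom T := fun S T =>
    generateFrom_union S T
  refine ⟨key _ _, ?_, ?_, ?_⟩
  · letI : TopologicalSpace M := Ou M O
    have hsub : ∀ S ∈ hyperPlus M '' BOfam M O,
        IsOpen[Ou M O] S ∧ ∃ A : Set X, S = hyperPlus M A := by
      rintro S ⟨A, hA, rfl⟩
      exact ⟨isOpen_generateFrom_of_mem ⟨A, hA, rfl⟩, A, rfl⟩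
    refine @IsTopologicalBasis.mk M (Ou M O) _ ?_ ?_ ?_
    · rintro S ⟨hS, A, rfl⟩ T ⟨hT, B, rfl⟩ F hF
      refine ⟨hyperPlus M A ∩ hyperPlus M B, ⟨hS.inter hT, A ∩ B, ?_⟩, hF, subset_rfl⟩
      ext G
      simp [hyperPlus]
    · refine eq_univ_of_forall fun F => ?_
      refine mem_sUnion.2 ⟨univ, ⟨isOpen_univ, univ, ?_⟩, mem_univ _⟩
      ext G
      simp [hyperPlus]
    · apply le_antisymm
      · exact le_generateFrom fun S hS => hS.1
      · exact generateFrom_anti hsub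
  · apply le_antisymm
    · exact le_generateFrom fun S hS => hS.1
    · refine generateFrom_anti ?_
      rintro S ⟨A, hA, rfl⟩
      exact ⟨isOpen_generateFrom_of_mem ⟨A, hA, rfl⟩, A, rfl⟩
  · unfold IsVietorisType Ou Ol
    rw [key]
end

section
/- Let (X,T) be a topological space, M ⊆ CL(X) be a natural family in X, and let O = (V_X)|_M be the subspace topology induced by the Vietoris topology. Then O is a strong Vietoris-type topology on M and T = T_O. In particular, for every T1-space X, the Vietoris topology V_X is a strong Vietoris-type topology on CL(X). -/
open Set TopologicalSpace Topology Cardinal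

universe u

variable {X : Type u}

/-- `CL(X)`: the nonempty closed subsets of `X`. -/
def CLset (X : Type u) [TopologicalSpace X] : Set (Set X) :=
  {F | IsClosed F ∧ F.Nonempty}

/-- The Vietoris topology `V_X` on `CL(X)`: the supremum of the upper Vietoris topology
(base `{U⁺ : U open}`) and the lower Vietoris topology (subbase `{U⁻ : U open}`), i.e.
the topology with subbase `{U⁺ : U open} ∪ {U⁻ : U open}`. -/
def vietoris (X : Type u) [TopologicalSpace X] : TopologicalSpace (CLset X) :=
  generateFrom (hyperPlus (CLset X) '' {U : Set X | IsOpen U} ∪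
    hyperMinus (CLset X) '' {U : Set X | IsOpen U})

lemma induced_vietoris_eq [T : TopologicalSpace X] (M : Set (Set X)) (h : M ⊆ CLset X) :
    TopologicalSpace.induced
          (fun F : M => (⟨(F : Set X), h F.2⟩ : CLset X)) (vietoris X) =
    generateFrom (hyperPlus M '' {U : Set X | IsOpen U} ∪
      hyperMinus M '' {U : Set X | IsOpen U}) := by
  rw [vietoris, induced_generateFrom_eq, image_union, image_image, image_image]
  rfl

lemma strong_aux [T : TopologicalSpace X] (M : Set (Set X)) (hM : ∀ x : X, {x} ∈ M)
    (O : TopologicalSpace M)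
    (hO : O = generateFrom (hyperPlus M '' {U : Set X | IsOpen U} ∪
      hyperMinus M '' {U : Set X | IsOpen U})) :
    IsStrongVietorisType M O ∧ TofO M O = T := by
  have hc : Continuous[T, O] (fun x : X => (⟨{x}, hM x⟩ : M)) := by
    rw [hO]
    refine continuous_generateFrom_iff.2 ?_
    rintro s (⟨U, hU, rfl⟩ | ⟨U, hU, rfl⟩)
    · simpa [hyperPlus] using hU
    · simpa [hyperMinus] using hU
  have hB : BOfam M O = {U : Set X | IsOpen U} := by
    ext A
    constructor
    · intro hA
      have := hc.isOpen_preimage _ hA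
      simpa [hyperPlus] using this
    · intro hA
      change IsOpen[O] _
      rw [hO]
      exact isOpen_generateFrom_of_mem (Or.inl ⟨A, hA, rfl⟩)
  have hP : POfam M O = {U : Set X | IsOpen U} := by
    ext A
    constructor
    · intro hA
      have := hc.isOpen_preimage _ hA
      simpa [hyperMinus] using this
    · intro hA
      change IsOpen[O] _
      rw [hO]
      exact isOpen_generateFrom_of_mem (Or.inr ⟨A, hA, rfl⟩)
  refine ⟨⟨?_, ?_⟩, ?_⟩
  · rw [IsVietorisType, hB, hP]; exact hO
  · rw [TplusO, TminusO, hB, hP]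
  · rw [TofO, hB, hP, union_self]
    exact generateFrom_setOf_isOpen T

/-- if `M ⊆ CL(X)` is a natural family and `O = (V_X)|_M`, then `O` is a
strong Vietoris-type topology on `M` and `T = T_O`.  In particular, for every
`T1`-space `X`, `V_X` is a strong Vietoris-type topology on `CL(X)`. -/
theorem statement2 [T : TopologicalSpace X] :
    (∀ M : Set (Set X), ∀ h : M ⊆ CLset X, (∀ x : X, {x} ∈ M) →
      IsStrongVietorisType M
        (TopologicalSpace.induced
          (fun F : M => (⟨(F : Set X), h F.2⟩ : CLset X)) (vietoris X)) ∧
      TofO M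
        (TopologicalSpace.induced
          (fun F : M => (⟨(F : Set X), h F.2⟩ : CLset X)) (vietoris X)) = T) ∧
    (T1Space X → IsStrongVietorisType (CLset X) (vietoris X)) := by
  refine ⟨fun M h hM => strong_aux M hM _ (induced_vietoris_eq M h), fun _ => ?_⟩
  exact (strong_aux (CLset X) (fun x => ⟨isClosed_singleton, singleton_nonempty x⟩) _ rfl).1
end

section
/- Let T be the natural topology on ℝ, U be the family of all open intervals (α,β) with α, β ∈ ℝ ∪ {−∞,+∞}, and let O be the topology on CL(ℝ) having as a subbase the family {I⁻ : I ∈ U} ∪ {I⁺ : I ∈ U}. Then O is a strong Vietoris-type topology on CL(ℝ), T_O coincides with T, and O is strictly coarser than the Vietoris topology V_ℝ on CL(ℝ); in particular, the set ((0,1) ∪ (1,2))⁺ belongs to V_ℝ but not to O. -/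
open Set TopologicalSpace Topology Cardinal

universe u

variable {X : Type u}

/-- The family `U` of all open intervals `(α,β)` with `α, β ∈ ℝ ∪ {−∞,+∞}`. -/
def intervalFamily : Set (Set ℝ) :=
  {I | ∃ a b : EReal, I = {x : ℝ | a < (x : EReal) ∧ (x : EReal) < b}}

/-- The topology `O` on `CL(ℝ)` with subbase `{I⁻ : I ∈ U} ∪ {I⁺ : I ∈ U}`. -/
def intervalHyperTop : TopologicalSpace (CLset ℝ) :=
  generateFrom (hyperMinus (CLset ℝ) '' intervalFamily ∪
    hyperPlus (CLset ℝ) '' intervalFamily)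

/-- The singleton `{x}` as an element of `CL(ℝ)`. -/
def singleCL (x : ℝ) : CLset ℝ := ⟨{x}, isClosed_singleton, singleton_nonempty x⟩

theorem single_preimage_plus (A : Set ℝ) : singleCL ⁻¹' (hyperPlus (CLset ℝ) A) = A := by
  ext x; simp [singleCL, hyperPlus]

theorem single_preimage_minus (A : Set ℝ) : singleCL ⁻¹' (hyperMinus (CLset ℝ) A) = A := by
  ext x; simp [singleCL, hyperMinus]

theorem isOpen_of_interval {I : Set ℝ} (h : I ∈ intervalFamily) : IsOpen I := by
  obtain ⟨a, b, rfl⟩ := h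
  exact (isOpen_Ioo (a := a) (b := b)).preimage continuous_coe_real_ereal

theorem single_isOpen {S : Set (CLset ℝ)} (h : IsOpen[intervalHyperTop] S) :
    IsOpen (singleCL ⁻¹' S) := by
  have hc : @Continuous _ _ _ intervalHyperTop singleCL := by
    refine continuous_generateFrom_iff.2 ?_
    rintro _ (⟨I, hI, rfl⟩ | ⟨I, hI, rfl⟩)
    · rw [single_preimage_minus]; exact isOpen_of_interval hI
    · rw [single_preimage_plus]; exact isOpen_of_interval hI
  exact @Continuous.isOpen_preimage _ _ _ intervalHyperTop _ hc S h

theorem isOpen_of_BO {A : Set ℝ} (h : A ∈ BOfam (CLset ℝ) intervalHyperTop) : IsOpen A := by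
  rw [← single_preimage_plus A]; exact single_isOpen h

theorem isOpen_of_PO {A : Set ℝ} (h : A ∈ POfam (CLset ℝ) intervalHyperTop) : IsOpen A := by
  rw [← single_preimage_minus A]; exact single_isOpen h

theorem interval_sub_BO : intervalFamily ⊆ BOfam (CLset ℝ) intervalHyperTop :=
  fun I hI => isOpen_generateFrom_of_mem (Or.inr ⟨I, hI, rfl⟩)

theorem interval_sub_PO : intervalFamily ⊆ POfam (CLset ℝ) intervalHyperTop :=
  fun I hI => isOpen_generateFrom_of_mem (Or.inl ⟨I, hI, rfl⟩)

theorem gen_eq {S : Set (Set ℝ)} (h1 : intervalFamily ⊆ S) (h2 : ∀ A ∈ S, IsOpen A) :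
    generateFrom S = (inferInstance : TopologicalSpace ℝ) := by
  apply le_antisymm
  · refine (generateFrom_anti h1).trans ?_
    have e : (inferInstance : TopologicalSpace ℝ) = _ :=
      OrderTopology.topology_eq_generate_intervals (α := ℝ)
    rw [e]
    apply generateFrom_anti
    rintro _ ⟨a, rfl | rfl⟩
    · exact ⟨a, ⊤, by ext x; simp⟩
    · exact ⟨⊥, a, by ext x; simp⟩
  · exact le_generateFrom h2

/-- The set `{1/2, 3/2}`. -/
def setF : CLset ℝ := ⟨{1/2, 3/2}, (Set.toFinite _).isClosed, by simp⟩

/-- The set `{1/2, 1, 3/2}`. -/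
def setG : CLset ℝ := ⟨{1/2, 1, 3/2}, (Set.toFinite _).isClosed, by simp⟩

theorem F_to_G {S : Set (CLset ℝ)} (h : IsOpen[intervalHyperTop] S) : setF ∈ S → setG ∈ S := by
  have h' : GenerateOpen (hyperMinus (CLset ℝ) '' intervalFamily ∪
    hyperPlus (CLset ℝ) '' intervalFamily) S := h
  induction h' with
  | basic s hs =>
    rcases hs with ⟨I, hI, rfl⟩ | ⟨I, hI, rfl⟩
    · rintro ⟨x, hx, hxI⟩
      refine ⟨x, ?_, hxI⟩
      rcases hx with rfl | rfl <;> simp [setG]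
    · intro hF
      obtain ⟨a, b, rfl⟩ := hI
      have h1 := hF (show (1/2 : ℝ) ∈ (setF : Set ℝ) by simp [setF])
      have h2 := hF (show (3/2 : ℝ) ∈ (setF : Set ℝ) by simp [setF])
      rintro x (rfl | rfl | rfl)
      · exact h1
      · exact ⟨h1.1.trans (EReal.coe_lt_coe_iff.2 (by norm_num)),
          lt_trans (EReal.coe_lt_coe_iff.2 (by norm_num)) h2.2⟩
      · exact h2
  | univ => exact fun _ => trivial
  | inter s t hs ht ihs iht => exact fun hF => ⟨ihs hs hF.1, iht ht hF.2⟩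
  | sUnion K hK ih => exact fun ⟨s, hs, hF⟩ => ⟨s, hs, ih s hs (hK s hs) hF⟩

theorem not_open_O :
    ¬ IsOpen[intervalHyperTop] (hyperPlus (CLset ℝ) (Ioo (0:ℝ) 1 ∪ Ioo (1:ℝ) 2)) := by
  intro h
  have hG := F_to_G h (by
    rintro x (rfl | rfl)
    · left; constructor <;> norm_num
    · right; constructor <;> norm_num)
  have := hG (show (1 : ℝ) ∈ (setG : Set ℝ) by simp [setG])
  simp at this

theorem open_V :
    IsOpen[vietoris ℝ] (hyperPlus (CLset ℝ) (Ioo (0:ℝ) 1 ∪ Ioo (1:ℝ) 2)) :=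
  isOpen_generateFrom_of_mem (Or.inl ⟨_, (isOpen_Ioo.union isOpen_Ioo :
    IsOpen (Ioo (0:ℝ) 1 ∪ Ioo (1:ℝ) 2)), rfl⟩)

/-- `O = intervalHyperTop` is a strong Vietoris-type topology on `CL(ℝ)`,
`T_O` is the natural topology of `ℝ`, and `O` is strictly coarser than the Vietoris
topology `V_ℝ` (in Mathlib's order on topologies, where finer topologies are smaller,
this reads `vietoris ℝ < O`); in particular `((0,1) ∪ (1,2))⁺` is open in `V_ℝ` but not
in `O`. -/
theorem statement3 :
    IsStrongVietorisType (CLset ℝ) intervalHyperTop ∧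
    TofO (CLset ℝ) intervalHyperTop = (inferInstance : TopologicalSpace ℝ) ∧
    vietoris ℝ < intervalHyperTop ∧
    IsOpen[vietoris ℝ] (hyperPlus (CLset ℝ) (Ioo (0:ℝ) 1 ∪ Ioo (1:ℝ) 2)) ∧
    ¬ IsOpen[intervalHyperTop] (hyperPlus (CLset ℝ) (Ioo (0:ℝ) 1 ∪ Ioo (1:ℝ) 2)) := by
  refine ⟨⟨?_, ?_⟩, ?_, ?_, open_V, not_open_O⟩
  · apply le_antisymm
    · apply le_generateFrom
      rintro _ (⟨A, hA, rfl⟩ | ⟨A, hA, rfl⟩)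
      · exact hA
      · exact hA
    · apply generateFrom_anti
      rintro _ (⟨A, hA, rfl⟩ | ⟨A, hA, rfl⟩)
      · exact Or.inr ⟨A, interval_sub_PO hA, rfl⟩
      · exact Or.inl ⟨A, interval_sub_BO hA, rfl⟩
  · exact (gen_eq interval_sub_BO fun _ => isOpen_of_BO).trans
      (gen_eq interval_sub_PO fun _ => isOpen_of_PO).symm
  · exact gen_eq (fun I hI => Or.inl (interval_sub_BO hI))
      fun A hA => hA.elim isOpen_of_BO isOpen_of_PO
  · refine lt_of_le_of_ne ?_ fun e => not_open_O (e ▸ open_V)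
    apply generateFrom_anti
    rintro _ (⟨A, hA, rfl⟩ | ⟨A, hA, rfl⟩)
    · exact Or.inr ⟨A, isOpen_of_interval hA, rfl⟩
    · exact Or.inl ⟨A, isOpen_of_interval hA, rfl⟩
end

section
/- Let (X,T) be a topological space, M ⊆ P'(X), n ∈ ℕ, Fin_n(X) ⊆ M, and let O be a Vietoris-type topology on M with T_O ⊆ T. Let J_n(X) be the subspace of (M,O) consisting of all elements of M of cardinality at most n. Then the map j_n : Xⁿ → J_n(X) defined by j_n(x_1,…,x_n) = {x_1,…,x_n} is continuous, where Xⁿ carries the product topology. -/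
open Set TopologicalSpace Topology Cardinal

universe u

variable {X : Type u}

/-- `J_n(X)`: the elements of `M` of cardinality at most `n`. -/
def Jn (M : Set (Set X)) (n : ℕ) : Set M :=
  {F | (F : Set X).Finite ∧ (F : Set X).ncard ≤ n}

/-- if `Fin_n(X) ⊆ M`, `O` is a Vietoris-type topology on `M` with
`T_O ⊆ T`, then the map `jₙ : Xⁿ → J_n(X)`, `(x₁,…,xₙ) ↦ {x₁,…,xₙ}`, is continuous,
where `Xⁿ` carries the product topology and `J_n(X)` the subspace topology of `(M,O)`. -/
theorem statement4 [T : TopologicalSpace X] (M : Set (Set X)) (hM : ∀ A ∈ M, A.Nonempty)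
    (n : ℕ) (hn : 0 < n)
    (hFin : {A : Set X | A.Nonempty ∧ A.Finite ∧ A.ncard ≤ n} ⊆ M)
    (O : TopologicalSpace M) (hV : IsVietorisType M O)
    (hTO : ∀ U : Set X, IsOpen[TofO M O] U → IsOpen U)
    (j : (Fin n → X) → Jn M n)
    (hj : ∀ x : Fin n → X, ((j x : M) : Set X) = Set.range x) :
    @Continuous (Fin n → X) (Jn M n) Pi.topologicalSpace
      (TopologicalSpace.induced Subtype.val O) j := by
  rw [continuous_induced_rng]
  refine (congrArg (fun t => @Continuous (Fin n → X) M Pi.topologicalSpace t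
    (Subtype.val ∘ j)) hV).mpr ?_
  refine continuous_generateFrom_iff.2 ?_
  rintro S (⟨A, hA, rfl⟩ | ⟨A, hA, rfl⟩)
  · have hAo : IsOpen A := hTO A (isOpen_generateFrom_of_mem (Or.inl hA))
    have : (Subtype.val ∘ j) ⁻¹' hyperPlus M A = ⋂ i : Fin n, (fun x : Fin n → X => x i) ⁻¹' A := by
      ext x
      simp [hyperPlus, hj, Set.range_subset_iff]
    rw [this]
    exact isOpen_iInter_of_finite fun i => hAo.preimage (continuous_apply i)
  · have hAo : IsOpen A := hTO A (isOpen_generateFrom_of_mem (Or.inr hA))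
    have : (Subtype.val ∘ j) ⁻¹' hyperMinus M A =
        ⋃ i : Fin n, (fun x : Fin n → X => x i) ⁻¹' A := by
      ext x
      simp [hyperMinus, hj, Set.Nonempty]
    rw [this]
    exact isOpen_iUnion fun i => hAo.preimage (continuous_apply i)
end

section
/- Let (X,T) be a topological space, M ⊆ P'(X) be a natural family in X, and let O be a Vietoris-type topology on M with T_O = T. Let J_1(X) be the subspace of (M,O) consisting of all singletons. Then the map j_1 : X → J_1(X), x ↦ {x}, is a homeomorphism. -/
open Set TopologicalSpace Topology Cardinal

universe u

variable {X : Type u}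

/-- `J₁(X)`: the singleton members of `M`. -/
def J1 (M : Set (Set X)) : Set M :=
  {F | ∃ x : X, (F : Set X) = {x}}

/-- if `M ⊆ P'(X)` is a natural family and `O` is a Vietoris-type topology
on `M` with `T_O = T`, then the map `j₁ : X → J₁(X)`, `x ↦ {x}`, is a homeomorphism
(where `J₁(X)` carries the subspace topology of `(M,O)`). -/
theorem statement5 [T : TopologicalSpace X] (M : Set (Set X)) (hM : ∀ A ∈ M, A.Nonempty)
    (hnat : ∀ x : X, {x} ∈ M)
    (O : TopologicalSpace M) (hV : IsVietorisType M O)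
    (hTO : TofO M O = T)
    (j : X → J1 M)
    (hj : ∀ x : X, ((j x : M) : Set X) = {x}) :
    @IsHomeomorph X (J1 M) T (TopologicalSpace.induced Subtype.val O) j := by
  have hp : ∀ A : Set X, (fun x => (j x : M)) ⁻¹' hyperPlus M A = A := by
    intro A; ext x; simp [hyperPlus, hj]
  have hm : ∀ A : Set X, (fun x => (j x : M)) ⁻¹' hyperMinus M A = A := by
    intro A; ext x; simp [hyperMinus, hj]
  have hT : T = TopologicalSpace.induced j (TopologicalSpace.induced Subtype.val O) := by
    rw [induced_compose]
    have hV' : O = generateFrom (hyperPlus M '' BOfam M O ∪ hyperMinus M '' POfam M O) := hV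
    have h2 : TopologicalSpace.induced (Subtype.val ∘ j) O = TopologicalSpace.induced
        (Subtype.val ∘ j)
        (generateFrom (hyperPlus M '' BOfam M O ∪ hyperMinus M '' POfam M O)) :=
      congrArg _ hV'
    rw [h2, induced_generateFrom_eq, image_union, image_image, image_image, ← hTO]
    have e1 : (fun A => (Subtype.val ∘ j) ⁻¹' hyperPlus M A) = id := funext hp
    have e2 : (fun A => (Subtype.val ∘ j) ⁻¹' hyperMinus M A) = id := funext hm
    rw [e1, e2, image_id, image_id]
    rfl
  have hinj : Function.Injective j := by
    intro x y h
    have : ({x} : Set X) = {y} := by rw [← hj x, ← hj y, h]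
    exact singleton_injective this
  have hsurj : Function.Surjective j := by
    rintro ⟨F, x, hx⟩
    exact ⟨x, Subtype.ext (Subtype.ext ((hj x).trans hx.symm))⟩
  letI : TopologicalSpace (J1 M) := TopologicalSpace.induced Subtype.val O
  have hind : IsInducing j := ⟨hT⟩
  exact ⟨hind.continuous, hind.isOpenMap (by rw [hsurj.range_eq]; exact isOpen_univ),
    hinj, hsurj⟩
end

section
/- Let (X,T) be a Hausdorff space, M ⊆ P'(X) be a natural family in X, and let O be a Vietoris-type topology on M with T ⊆ T_{-O}. Then J_1(X), the set of all singletons, is a closed subset of (M,O). -/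
open Set TopologicalSpace Topology Cardinal

universe u

variable {X : Type u}

theorem nhd_aux (M : Set (Set X)) (O : TopologicalSpace M) (U : Set X)
    (hU : GenerateOpen (POfam M O) U) (F : M) (x : X) (hxF : x ∈ (F : Set X)) (hx : x ∈ U) :
    ∃ N : Set M, IsOpen[O] N ∧ F ∈ N ∧ ∀ G ∈ N, ∀ z : X, (G : Set X) = {z} → z ∈ U := by
  induction hU with
  | basic s hs =>
    refine ⟨hyperMinus M s, hs, ⟨x, hxF, hx⟩, ?_⟩
    rintro G ⟨w, hw, hws⟩ z hz
    rw [hz] at hw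
    rw [← (hw : w = z)]
    exact hws
  | univ => exact ⟨Set.univ, O.isOpen_univ, trivial, fun _ _ _ _ => trivial⟩
  | inter s t _ _ ih1 ih2 =>
    obtain ⟨N1, o1, f1, h1⟩ := ih1 hx.1
    obtain ⟨N2, o2, f2, h2⟩ := ih2 hx.2
    exact ⟨N1 ∩ N2, O.isOpen_inter _ _ o1 o2, ⟨f1, f2⟩,
      fun G hG z hz => ⟨h1 G hG.1 z hz, h2 G hG.2 z hz⟩⟩
  | sUnion S _ ih =>
    obtain ⟨s, hs, hxs⟩ := hx
    obtain ⟨N, o, f, h⟩ := ih s hs hxs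
    exact ⟨N, o, f, fun G hG z hz => ⟨s, hs, h G hG z hz⟩⟩

/-- if `X` is Hausdorff, `M ⊆ P'(X)` is a natural family in `X`, and `O`
is a Vietoris-type topology on `M` with `T ⊆ T₋O`, then `J₁(X)` is closed in `(M,O)`. -/
theorem statement6 [T : TopologicalSpace X] [T2Space X]
    (M : Set (Set X)) (hM : ∀ A ∈ M, A.Nonempty)
    (hnat : ∀ x : X, {x} ∈ M)
    (O : TopologicalSpace M) (hV : IsVietorisType M O)
    (hsub : ∀ U : Set X, IsOpen U → IsOpen[TminusO M O] U) :
    IsClosed[O] (J1 M) := by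
  rw [← @isOpen_compl_iff _ _ O, isOpen_iff_forall_mem_open]
  intro F hF
  obtain ⟨x, hx⟩ := hM F F.2
  have hy : ∃ y ∈ (F : Set X), y ≠ x := by
    by_contra hcon
    push Not at hcon
    exact hF ⟨x, Set.eq_singleton_iff_unique_mem.2 ⟨hx, hcon⟩⟩
  obtain ⟨y, hyF, hyx⟩ := hy
  obtain ⟨U, V, hU, hV', hyU, hxV, hd⟩ := t2_separation hyx
  obtain ⟨N1, o1, f1, h1⟩ := nhd_aux M O U (hsub U hU) F y hyF hyU
  obtain ⟨N2, o2, f2, h2⟩ := nhd_aux M O V (hsub V hV') F x hx hxV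
  refine ⟨N1 ∩ N2, ?_, O.isOpen_inter _ _ o1 o2, ⟨f1, f2⟩⟩
  rintro G ⟨g1, g2⟩ ⟨z, hz⟩
  exact Set.disjoint_left.1 hd (h1 G g1 z hz) (h2 G g2 z hz)
end

section
/- Let (X,T) be a topological space, M ⊆ P'(X) with Fin_2(X) ⊆ M, and let O be a Vietoris-type topology on M with T_O ⊆ T. If J_1(X), the set of all singletons, is closed in (M,O), then X is a Hausdorff space. -/
open Set TopologicalSpace Topology Cardinal

universe u

variable {X : Type u}

/-- if `Fin₂(X) ⊆ M`, `O` is a Vietoris-type topology on `M` with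
`T_O ⊆ T`, and `J₁(X)` is closed in `(M,O)`, then `X` is Hausdorff. -/
theorem statement7 [T : TopologicalSpace X]
    (M : Set (Set X)) (hM : ∀ A ∈ M, A.Nonempty)
    (hFin2 : {A : Set X | A.Nonempty ∧ A.Finite ∧ A.ncard ≤ 2} ⊆ M)
    (O : TopologicalSpace M) (hV : IsVietorisType M O)
    (hTO : ∀ U : Set X, IsOpen[TofO M O] U → IsOpen U)
    (hcl : IsClosed[O] (J1 M)) :
    T2Space X := by
  have hp : ∀ q : X × X, ({q.1, q.2} : Set X) ∈ M := fun q =>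
    hFin2 ⟨⟨q.1, by simp⟩, by simp, by
      have h := Set.ncard_insert_le q.1 ({q.2} : Set X)
      rwa [Set.ncard_singleton] at h⟩
  let p : X × X → M := fun q => ⟨{q.1, q.2}, hp q⟩
  have hcont : @Continuous _ _ _ O p := by
    unfold IsVietorisType at hV
    rw [hV]
    refine continuous_generateFrom_iff.2 ?_
    rintro _ (⟨A, hA, rfl⟩ | ⟨A, hA, rfl⟩)
    · have hAo : IsOpen A := hTO A (isOpen_generateFrom_of_mem (Or.inl hA))
      have : p ⁻¹' hyperPlus M A = A ×ˢ A := by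
        ext q
        simp [p, hyperPlus, Set.insert_subset_iff]
      rw [this]
      exact hAo.prod hAo
    · have hAo : IsOpen A := hTO A (isOpen_generateFrom_of_mem (Or.inr hA))
      have : p ⁻¹' hyperMinus M A = Prod.fst ⁻¹' A ∪ Prod.snd ⁻¹' A := by
        ext q
        simp [p, hyperMinus, Set.Nonempty]
      rw [this]
      exact (hAo.preimage continuous_fst).union (hAo.preimage continuous_snd)
  rw [t2_iff_isClosed_diagonal]
  have : diagonal X = p ⁻¹' J1 M := by
    ext ⟨a, b⟩
    simp only [mem_diagonal_iff, mem_preimage, J1, mem_ofPred_eq, p]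
    constructor
    · rintro rfl
      exact ⟨a, by simp⟩
    · rintro ⟨x, hx⟩
      have ha : a ∈ ({x} : Set X) := hx ▸ (by simp)
      have hb : b ∈ ({x} : Set X) := hx ▸ (by simp)
      exact ha.trans hb.symm
  rw [this]
  exact hcl.preimage hcont
end

section
/- Let X be a set, M ⊆ P'(X) with Fin(X) ⊆ M, and let O be a Vietoris-type topology on M. Then J(X), the set of all nonempty finite elements of M, is dense in (M,O). -/
open Set TopologicalSpace Topology Cardinal

universe u

variable {X : Type u}

theorem finite_witness_aux (M : Set (Set X)) (B P : Set (Set X)) (U : Set M)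
    (hU : GenerateOpen (hyperPlus M '' B ∪ hyperMinus M '' P) U) :
    ∀ F ∈ U, ∃ T : Set X, T.Finite ∧ T ⊆ (F : Set X) ∧
      ∀ G : M, T ⊆ (G : Set X) → (G : Set X) ⊆ (F : Set X) → G ∈ U := by
  induction hU with
  | basic s hs =>
    intro F hF
    rcases hs with ⟨A, -, rfl⟩ | ⟨A, -, rfl⟩
    · exact ⟨∅, finite_empty, empty_subset _, fun G _ h => h.trans hF⟩
    · obtain ⟨x, hx, hxA⟩ := hF
      exact ⟨{x}, finite_singleton x, singleton_subset_iff.2 hx,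
        fun G h _ => ⟨x, singleton_subset_iff.1 h, hxA⟩⟩
  | univ =>
    intro F _
    exact ⟨∅, finite_empty, empty_subset _, fun G _ _ => mem_univ G⟩
  | inter s t _ _ ihs iht =>
    intro F hF
    obtain ⟨T, h1, h2, h3⟩ := ihs F hF.1
    obtain ⟨T', h1', h2', h3'⟩ := iht F hF.2
    exact ⟨T ∪ T', h1.union h1', union_subset h2 h2', fun G h h' =>
      ⟨h3 G (subset_union_left.trans h) h', h3' G (subset_union_right.trans h) h'⟩⟩
  | sUnion S _ ih =>
    intro F hF
    obtain ⟨s, hs, hFs⟩ := hF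
    obtain ⟨T, h1, h2, h3⟩ := ih s hs F hFs
    exact ⟨T, h1, h2, fun G h h' => ⟨s, hs, h3 G h h'⟩⟩

/-- if `Fin(X) ⊆ M` and `O` is a Vietoris-type topology on `M`, then
`J(X)`, the set of all nonempty finite elements of `M`, is dense in `(M,O)`. -/
theorem statement8 (M : Set (Set X)) (hM : ∀ A ∈ M, A.Nonempty)
    (hFin : {A : Set X | A.Nonempty ∧ A.Finite} ⊆ M)
    (O : TopologicalSpace M) (hV : IsVietorisType M O) :
    @Dense M O {F : M | (F : Set X).Nonempty ∧ (F : Set X).Finite} := by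
  rw [@dense_iff_inter_open M O]
  rintro U hU ⟨F, hF⟩
  rw [hV] at hU
  obtain ⟨T, h1, h2, h3⟩ := finite_witness_aux M _ _ U hU F hF
  obtain ⟨x, hx⟩ := hM F F.2
  have hf : (insert x T).Finite := h1.insert x
  have hn : (insert x T).Nonempty := insert_nonempty x T
  exact ⟨⟨insert x T, hFin ⟨hn, hf⟩⟩,
    h3 _ (subset_insert x T) (insert_subset hx h2), hn, hf⟩
end

section
/- Let X be a topological space with weight w(X) = τ ≥ ℵ₀ and let P be a subbase for X. Then there exists P' ⊆ P such that |P'| = τ and P' is a subbase for X. -/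
open Set TopologicalSpace Topology Cardinal

universe u

/-- The weight of a topological space: the minimal cardinality of a (topological) base. -/
noncomputable def weightOf (X : Type u) (t : TopologicalSpace X) : Cardinal :=
  sInf {c | ∃ B : Set (Set X), @IsTopologicalBasis X t B ∧ Cardinal.mk B = c}

/-- if `X` is a topological space with `w(X) = τ ≥ ℵ₀` and `P` is a subbase
for `X`, then there exists `P' ⊆ P` with `|P'| = τ` which is a subbase for `X`. -/
theorem statement9 {X : Type u} [T : TopologicalSpace X] (τ : Cardinal)
    (hw : weightOf X T = τ) (hτ : ℵ₀ ≤ τ)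
    (P : Set (Set X)) (hP : T = generateFrom P) :
    ∃ P' ⊆ P, Cardinal.mk P' = τ ∧ T = generateFrom P' := by
  classical
  -- a base of cardinality exactly the weight
  have hne : {c | ∃ B : Set (Set X), @IsTopologicalBasis X T B ∧ Cardinal.mk B = c}.Nonempty :=
    ⟨_, _, isTopologicalBasis_opens, rfl⟩
  obtain ⟨B, hB, hBc⟩ := csInf_mem hne
  have hBτ : Cardinal.mk B = τ := hBc.trans hw
  have hmin : ∀ C : Set (Set X), IsTopologicalBasis C → τ ≤ Cardinal.mk C := by
    intro C hC
    rw [← hw]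
    exact csInf_le' ⟨C, hC, rfl⟩
  have hPb := isTopologicalBasis_of_subbasis hP
  -- choose a finite subfamily of `P` between `U` and `V` whenever possible
  have hch : ∀ q : B × B, ∃ F : Set (Set X), F.Finite ∧ F ⊆ P ∧
      ((∃ G : Set (Set X), G.Finite ∧ G ⊆ P ∧ (q.1 : Set X) ⊆ ⋂₀ G ∧ ⋂₀ G ⊆ (q.2 : Set X)) →
        (q.1 : Set X) ⊆ ⋂₀ F ∧ ⋂₀ F ⊆ (q.2 : Set X)) := by
    intro q
    by_cases h : ∃ G : Set (Set X), G.Finite ∧ G ⊆ P ∧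
        (q.1 : Set X) ⊆ ⋂₀ G ∧ ⋂₀ G ⊆ (q.2 : Set X)
    · obtain ⟨G, h1, h2, h3⟩ := h
      exact ⟨G, h1, h2, fun _ => h3⟩
    · exact ⟨∅, finite_empty, empty_subset _, fun h' => absurd h' h⟩
  choose F hFfin hFP hF using hch
  have hsub : (⋃ q, F q) ⊆ P := iUnion_subset hFP
  have hgen : T = generateFrom (⋃ q, F q) := by
    apply le_antisymm
    · rw [le_generateFrom_iff_subset_isOpen]
      intro s hs
      have := isOpen_generateFrom_of_mem (hsub hs)
      rw [← hP] at this
      exact this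
    · rw [hB.eq_generateFrom]
      refine le_generateFrom fun V hV => ?_
      refine (@isOpen_iff_forall_mem_open X (generateFrom (⋃ q, F q)) V).2 fun x hx => ?_
      obtain ⟨W, ⟨G, ⟨hG1, hG2⟩, rfl⟩, hxW, hWV⟩ :=
        hPb.exists_subset_of_mem_open hx (hB.isOpen hV)
      obtain ⟨U, hU, hxU, hUW⟩ :=
        hB.exists_subset_of_mem_open hxW (hPb.isOpen ⟨G, ⟨hG1, hG2⟩, rfl⟩)
      obtain ⟨h1, h2⟩ := hF (⟨U, hU⟩, ⟨V, hV⟩) ⟨G, hG1, hG2, hUW, hWV⟩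
      refine ⟨_, h2, ?_, h1 hxU⟩
      refine @Set.Finite.isOpen_sInter X (generateFrom (⋃ q, F q)) _ (hFfin _) fun s hs => ?_
      exact isOpen_generateFrom_of_mem (mem_iUnion.2 ⟨_, hs⟩)
  refine ⟨⋃ q, F q, hsub, le_antisymm ?_ ?_, hgen⟩
  · refine (mk_iUnion_le F).trans ?_
    have h1 : Cardinal.mk (B × B) = τ := by
      rw [mk_prod, lift_id, hBτ, mul_eq_self hτ]
    rw [h1]
    refine (mul_le_mul_right (ciSup_le' fun q => ?_) τ).trans (mul_eq_self hτ).le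
    exact ((hFfin q).lt_aleph0.le).trans hτ
  · have hb := hmin _ (isTopologicalBasis_of_subbasis hgen)
    have hle : Cardinal.mk ((fun f => ⋂₀ f) '' {f : Set (Set X) | f.Finite ∧ f ⊆ ⋃ q, F q}) ≤
        Cardinal.mk (Finset (⋃ q, F q : Set (Set X))) := by
      refine (mk_le_mk_of_subset ?_).trans (mk_range_le
        (f := fun f : Finset (⋃ q, F q : Set (Set X)) => ⋂₀ (Subtype.val '' (f : Set (⋃ q, F q : Set (Set X))))))
      rintro _ ⟨f, ⟨hf, hfs⟩, rfl⟩
      refine ⟨(hf.preimage Subtype.val_injective.injOn).toFinset, ?_⟩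
      simp only [Set.Finite.coe_toFinset]
      rw [Subtype.image_preimage_coe, inter_eq_right.2 hfs]
    have h := hb.trans hle
    cases finite_or_infinite (⋃ q, F q : Set (Set X))
    · exact absurd (hτ.trans h) (not_le.2 (lt_aleph0_of_finite _))
    · rwa [mk_finset_of_infinite] at h
end

section
/- Let (X,T) be a topological space, M ⊆ P'(X) with Fin(X) ⊆ M, and let O be a Vietoris-type topology on M with T_O = T. If the density d(X) ≥ ℵ₀, then d(M,O) ≤ d(X). -/
open Set TopologicalSpace Topology Cardinal

universe u

variable {X : Type u}

/-- The density of a topological space: the minimal cardinality of a dense subset. -/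
noncomputable def densityOf (Y : Type u) (t : TopologicalSpace Y) : Cardinal :=
  sInf {c | ∃ D : Set Y, @Dense Y t D ∧ Cardinal.mk D = c}

lemma nbhd_aux (M : Set (Set X)) (O : TopologicalSpace M) (hV : IsVietorisType M O)
    (F : M) (W : Set M) (hW : IsOpen[O] W) (hF : F ∈ W) :
    ∃ (U : Set X) (C : Set (Set X)), IsOpen[TofO M O] U ∧ (F : Set X) ⊆ U ∧ C.Finite ∧
      (∀ c ∈ C, IsOpen[TofO M O] c ∧ ((F : Set X) ∩ c).Nonempty) ∧
      ∀ G : M, (G : Set X) ⊆ U → (∀ c ∈ C, ((G : Set X) ∩ c).Nonempty) → G ∈ W := by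
  have hW' : GenerateOpen (hyperPlus M '' BOfam M O ∪ hyperMinus M '' POfam M O) W := by
    have h := hW
    rw [hV] at h
    exact h
  clear hW
  induction hW' with
  | basic s hs =>
    rcases hs with ⟨A, hA, rfl⟩ | ⟨A, hA, rfl⟩
    · exact ⟨A, ∅, GenerateOpen.basic _ (Or.inl hA), hF, Set.finite_empty, by simp,
        fun G hG _ => hG⟩
    · refine ⟨univ, {A}, GenerateOpen.univ, subset_univ _, Set.finite_singleton _, ?_, ?_⟩
      · rintro c rfl
        exact ⟨GenerateOpen.basic _ (Or.inr hA), hF⟩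
      · intro G _ h
        exact h A rfl
  | univ =>
    exact ⟨univ, ∅, GenerateOpen.univ, subset_univ _, Set.finite_empty, by simp,
      fun G _ _ => trivial⟩
  | inter s t _ _ ihs iht =>
    obtain ⟨U, C, hU, hFU, hC, hCo, h⟩ := ihs hF.1
    obtain ⟨U', C', hU', hFU', hC', hCo', h'⟩ := iht hF.2
    refine ⟨U ∩ U', C ∪ C', GenerateOpen.inter _ _ hU hU', subset_inter hFU hFU',
      hC.union hC', ?_, ?_⟩
    · rintro c (hc | hc)
      · exact hCo c hc
      · exact hCo' c hc
    · intro G hG hGc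
      exact ⟨h G (hG.trans inter_subset_left) fun c hc => hGc c (Or.inl hc),
        h' G (hG.trans inter_subset_right) fun c hc => hGc c (Or.inr hc)⟩
  | sUnion S _ ih =>
    obtain ⟨s, hs, hFs⟩ := hF
    obtain ⟨U, C, hU, hFU, hC, hCo, h⟩ := ih s hs hFs
    exact ⟨U, C, hU, hFU, hC, hCo, fun G h1 h2 => ⟨s, hs, h G h1 h2⟩⟩

/-- if `Fin(X) ⊆ M`, `O` is a Vietoris-type topology on `M` with
`T_O = T`, and `d(X) ≥ ℵ₀`, then `d(M,O) ≤ d(X)`. -/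
theorem statement13 [T : TopologicalSpace X]
    (M : Set (Set X)) (hM : ∀ A ∈ M, A.Nonempty)
    (hFin : {A : Set X | A.Nonempty ∧ A.Finite} ⊆ M)
    (O : TopologicalSpace M) (hV : IsVietorisType M O)
    (hTO : TofO M O = T)
    (hd : ℵ₀ ≤ densityOf X T) :
    densityOf M O ≤ densityOf X T := by
  classical
  have hne : {c | ∃ D : Set X, @Dense X T D ∧ Cardinal.mk D = c}.Nonempty :=
    ⟨_, univ, dense_univ, rfl⟩
  obtain ⟨D, hD, hDc⟩ := csInf_mem hne
  change _ = densityOf X T at hDc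
  rw [← hDc] at hd ⊢
  have hinf : Infinite D := Cardinal.infinite_iff.2 hd
  let f : {s : Finset D // s.Nonempty} → M := fun s =>
    ⟨Subtype.val '' (s.1 : Set D), hFin ⟨s.2.to_set.image _, s.1.finite_toSet.image _⟩⟩
  have hdense : @Dense M O (range f) := by
    intro F
    rw [mem_closure_iff]
    intro W hW hF
    obtain ⟨U, C, hU, hFU, hC, hCo, h⟩ := nbhd_aux M O hV F W hW hF
    rw [hTO] at hU hCo
    have key : ∀ c ∈ insert Set.univ C, ∃ d : D, (d : X) ∈ U ∩ c := by
      intro c hc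
      have hc' : IsOpen[T] c ∧ ((F : Set X) ∩ c).Nonempty := by
        rcases hc with rfl | hc
        · exact ⟨isOpen_univ, by simpa using hM F F.2⟩
        · exact hCo c hc
      obtain ⟨x, hx, hxc⟩ := hc'.2
      obtain ⟨y, hy, hyD⟩ := hD.inter_open_nonempty (U ∩ c) (hU.inter hc'.1) ⟨x, hFU hx, hxc⟩
      exact ⟨⟨y, hyD⟩, hy⟩
    choose! g hg using key
    have hfin : (g '' insert Set.univ C).Finite := (hC.insert Set.univ).image g
    have hn : hfin.toFinset.Nonempty := by
      simp
    refine ⟨f ⟨hfin.toFinset, hn⟩, h _ ?_ ?_, mem_range_self _⟩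
    · rintro _ ⟨d, hd, rfl⟩
      rw [Finset.mem_coe, Set.Finite.mem_toFinset] at hd
      obtain ⟨c, hc, rfl⟩ := hd
      exact (hg c hc).1
    · intro c hc
      refine ⟨g c, ⟨g c, ?_, rfl⟩, (hg c (Or.inr hc)).2⟩
      rw [Finset.mem_coe, Set.Finite.mem_toFinset]
      exact ⟨c, Or.inr hc, rfl⟩
  calc densityOf M O ≤ Cardinal.mk (range f) := csInf_le' ⟨_, hdense, rfl⟩
    _ ≤ Cardinal.mk {s : Finset D // s.Nonempty} := Cardinal.mk_range_le
    _ ≤ Cardinal.mk (Finset D) := Cardinal.mk_subtype_le _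
    _ = Cardinal.mk D := Cardinal.mk_finset_of_infinite D
end

section
/- Let X be a set, M ⊆ P'(X) and O be a topology on M. If M ⊆ {X∖A : A ∈ P_O} or M ⊆ B_O, then (M,O) is a T0-space. -/
open Set TopologicalSpace Topology Cardinal

universe u

variable {X : Type u}

/-- if `M ⊆ {X∖A : A ∈ P_O}` or `M ⊆ B_O`, then `(M,O)` is a `T0`-space. -/
theorem statement14 (M : Set (Set X)) (hM : ∀ A ∈ M, A.Nonempty)
    (O : TopologicalSpace M)
    (h : M ⊆ {B | ∃ A ∈ POfam M O, B = Aᶜ} ∨ M ⊆ BOfam M O) :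
    @T0Space M O := by
  have key : ∀ F G : M, @Inseparable M O F G → (F : Set X) ⊆ G := by
    intro F G hFG
    rcases h with h | h
    · obtain ⟨A, hA, hGA⟩ := h G.2
      have h1 : F ∈ hyperMinus M A ↔ G ∈ hyperMinus M A :=
        (@inseparable_iff_forall_isOpen M O F G).1 hFG _ hA
      have h2 : G ∉ hyperMinus M A := by
        rintro ⟨x, hx, hxA⟩
        rw [hGA] at hx
        exact hx hxA
      intro x hx
      rw [hGA]
      intro hxA
      exact h2 (h1.1 ⟨x, hx, hxA⟩)
    · have h1 : F ∈ hyperPlus M G ↔ G ∈ hyperPlus M G :=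
        (@inseparable_iff_forall_isOpen M O F G).1 hFG _ (h G.2)
      exact h1.2 (fun x hx => hx)
  refine @T0Space.mk M O ?_
  intro F G hFG
  exact Subtype.ext (Subset.antisymm (key F G hFG) (key G F (@Inseparable.symm M O F G hFG)))
end

section
/- Let (X,T) be a topological space, M ⊆ P'(X), P be a subbase for T with M ⊆ {X∖U : U ∈ P}, and let M be a natural family in X. Let O be the topology on M having as a subbase the family {U⁻_M : U ∈ P} ∪ {U⁺_M : U ∈ P}. Then O is a strong Vietoris-type topology on M, T_O = T, and (M,O) is a T1-space. -/
open Set TopologicalSpace Topology Cardinal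

universe u

variable {X : Type u}

/-- let `P` be a subbase for `(X,T)`, `M ⊆ P'(X)` a natural family with
`M ⊆ {X∖U : U ∈ P}`, and `O` the topology on `M` with subbase
`{U⁻_M : U ∈ P} ∪ {U⁺_M : U ∈ P}`.  Then `O` is a strong Vietoris-type topology on `M`,
`T_O = T`, and `(M,O)` is a `T1`-space. -/
theorem statement15 [T : TopologicalSpace X]
    (M : Set (Set X)) (hM : ∀ A ∈ M, A.Nonempty)
    (P : Set (Set X)) (hP : T = generateFrom P)
    (hMP : M ⊆ {B | ∃ U ∈ P, B = Uᶜ})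
    (hnat : ∀ x : X, {x} ∈ M) :
    IsStrongVietorisType M (generateFrom (hyperMinus M '' P ∪ hyperPlus M '' P)) ∧
    TofO M (generateFrom (hyperMinus M '' P ∪ hyperPlus M '' P)) = T ∧
    @T1Space M (generateFrom (hyperMinus M '' P ∪ hyperPlus M '' P)) := by
  have hm : ∀ U ∈ P, IsOpen[generateFrom (hyperMinus M '' P ∪ hyperPlus M '' P)]
      (hyperMinus M U) := fun U hU =>
    isOpen_generateFrom_of_mem (Or.inl ⟨U, hU, rfl⟩)
  have hp : ∀ U ∈ P, IsOpen[generateFrom (hyperMinus M '' P ∪ hyperPlus M '' P)]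
      (hyperPlus M U) := fun U hU =>
    isOpen_generateFrom_of_mem (Or.inr ⟨U, hU, rfl⟩)
  have prem : ∀ A : Set X, (fun x : X => (⟨{x}, hnat x⟩ : M)) ⁻¹' (hyperMinus M A) = A := by
    intro A; ext x; simp [hyperMinus]
  have prep : ∀ A : Set X, (fun x : X => (⟨{x}, hnat x⟩ : M)) ⁻¹' (hyperPlus M A) = A := by
    intro A; ext x; simp [hyperPlus]
  have hPo : ∀ U ∈ P, IsOpen[T] U := by
    intro U hU
    rw [hP]
    exact isOpen_generateFrom_of_mem hU
  have hc : @Continuous X M T (generateFrom (hyperMinus M '' P ∪ hyperPlus M '' P))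
      (fun x : X => (⟨{x}, hnat x⟩ : M)) := by
    refine continuous_generateFrom_iff.2 ?_
    rintro _ (⟨U, hU, rfl⟩ | ⟨U, hU, rfl⟩)
    · rw [prem]; exact hPo U hU
    · rw [prep]; exact hPo U hU
  generalize hO : generateFrom (hyperMinus M '' P ∪ hyperPlus M '' P) = O at *
  have hB : ∀ A ∈ BOfam M O, IsOpen[T] A := by
    intro A hA
    rw [← prep A]
    exact hc.isOpen_preimage _ hA
  have hQ : ∀ A ∈ POfam M O, IsOpen[T] A := by
    intro A hA
    rw [← prem A]
    exact hc.isOpen_preimage _ hA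
  have key : ∀ S : Set (Set X), P ⊆ S → (∀ A ∈ S, IsOpen[T] A) → generateFrom S = T := by
    intro S h1 h2
    apply le_antisymm
    · rw [hP]; exact generateFrom_anti h1
    · exact le_generateFrom h2
  refine ⟨⟨?_, ?_⟩, ?_, ?_⟩
  · unfold IsVietorisType
    apply le_antisymm
    · apply le_generateFrom
      rintro _ (⟨U, hU, rfl⟩ | ⟨U, hU, rfl⟩)
      · exact hU
      · exact hU
    · conv_rhs => rw [← hO]
      apply generateFrom_anti
      rintro _ (⟨U, hU, rfl⟩ | ⟨U, hU, rfl⟩)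
      · exact Or.inr ⟨U, hm U hU, rfl⟩
      · exact Or.inl ⟨U, hp U hU, rfl⟩
  · exact (key _ hp hB).trans (key _ hm hQ).symm
  · exact key _ (fun U hU => Or.inl (hp U hU)) (fun A hA => hA.elim (hB A) (hQ A))
  · letI := O
    rw [t1Space_iff_exists_open]
    intro G F hne
    by_cases hGF : (G : Set X) ⊆ F
    · have : ∃ x ∈ (F : Set X), x ∉ (G : Set X) := by
        by_contra! h
        exact hne (Subtype.ext (hGF.antisymm h))
      obtain ⟨x, hxF, hxG⟩ := this
      obtain ⟨V, hV, hxV⟩ := hMP (hnat x)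
      refine ⟨hyperPlus M V, hp V hV, ?_, ?_⟩
      · intro y hy
        by_contra hyV
        have : y ∈ ({x} : Set X) := by rw [hxV]; exact hyV
        rw [mem_singleton_iff.1 this] at hy
        exact hxG hy
      · intro h
        have : x ∈ Vᶜ := by rw [← hxV]; rfl
        exact this (h hxF)
    · obtain ⟨U, hU, hFU⟩ := hMP F.2
      obtain ⟨y, hyG, hyF⟩ := not_subset.1 hGF
      refine ⟨hyperMinus M U, hm U hU, ⟨y, hyG, ?_⟩, ?_⟩
      · by_contra h
        exact hyF (by rw [hFU]; exact h)
      · rintro ⟨z, hzF, hzU⟩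
        rw [hFU] at hzF
        exact hzF hzU
end

section
/- Let (X,T) be a topological space, M ⊆ P'(X), P be a subbase for T with M ⊆ {X∖U : U ∈ P}, let M be a natural family in X, and suppose X is P-regular. Let O be the topology on M having as a subbase the family {U⁻_M : U ∈ P} ∪ {U⁺_M : U ∈ P}. Then O is a strong Vietoris-type topology on M, T_O = T, and (M,O) is a Hausdorff space. -/
open Set TopologicalSpace Topology Cardinal

universe u

variable {X : Type u}

/-- `X` is `P`-regular: for every `x ∈ X` and `U ∈ P` with `x ∈ U` there are
`V, W ∈ P` with `x ∈ V ⊆ X∖W ⊆ U`. -/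
def PRegular (P : Set (Set X)) : Prop :=
  ∀ x : X, ∀ U ∈ P, x ∈ U → ∃ V ∈ P, ∃ W ∈ P, x ∈ V ∧ V ⊆ Wᶜ ∧ Wᶜ ⊆ U

/-- let `P` be a subbase for `(X,T)`, `M ⊆ P'(X)` a natural family with
`M ⊆ {X∖U : U ∈ P}`, let `X` be `P`-regular, and let `O` be the topology on `M` with
subbase `{U⁻_M : U ∈ P} ∪ {U⁺_M : U ∈ P}`.  Then `O` is a strong Vietoris-type topology
on `M`, `T_O = T`, and `(M,O)` is Hausdorff. -/
theorem statement16 [T : TopologicalSpace X]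
    (M : Set (Set X)) (hM : ∀ A ∈ M, A.Nonempty)
    (P : Set (Set X)) (hP : T = generateFrom P)
    (hMP : M ⊆ {B | ∃ U ∈ P, B = Uᶜ})
    (hnat : ∀ x : X, {x} ∈ M)
    (hreg : PRegular P) :
    IsStrongVietorisType M (generateFrom (hyperMinus M '' P ∪ hyperPlus M '' P)) ∧
    TofO M (generateFrom (hyperMinus M '' P ∪ hyperPlus M '' P)) = T ∧
    @T2Space M (generateFrom (hyperMinus M '' P ∪ hyperPlus M '' P)) := by
  set O : TopologicalSpace M :=
    generateFrom (hyperMinus M '' P ∪ hyperPlus M '' P) with hO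
  have hPB : P ⊆ BOfam M O := fun U hU =>
    isOpen_generateFrom_of_mem (Or.inr ⟨U, hU, rfl⟩)
  have hPP : P ⊆ POfam M O := fun U hU =>
    isOpen_generateFrom_of_mem (Or.inl ⟨U, hU, rfl⟩)
  have preP : ∀ A : Set X,
      (fun x : X => (⟨{x}, hnat x⟩ : M)) ⁻¹' hyperPlus M A = A := by
    intro A; ext x; simp [hyperPlus]
  have preM : ∀ A : Set X,
      (fun x : X => (⟨{x}, hnat x⟩ : M)) ⁻¹' hyperMinus M A = A := by
    intro A; ext x; simp [hyperMinus]
  have hc : @Continuous X M T O (fun x : X => (⟨{x}, hnat x⟩ : M)) := by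
    rw [hO, continuous_generateFrom_iff]
    rintro s (⟨U, hU, rfl⟩ | ⟨U, hU, rfl⟩)
    · rw [preM, hP]; exact isOpen_generateFrom_of_mem hU
    · rw [preP, hP]; exact isOpen_generateFrom_of_mem hU
  have hB : ∀ A ∈ BOfam M O, IsOpen[T] A := by
    intro A hA
    have h := hA.preimage hc
    rwa [preP] at h
  have hPo : ∀ A ∈ POfam M O, IsOpen[T] A := by
    intro A hA
    have h := hA.preimage hc
    rwa [preM] at h
  have key : ∀ S : Set (Set X), P ⊆ S → (∀ A ∈ S, IsOpen[T] A) →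
      generateFrom S = T := by
    intro S h1 h2
    apply le_antisymm
    · rw [hP]; exact generateFrom_anti h1
    · exact le_generateFrom h2
  refine ⟨⟨?_, ?_⟩, ?_, ?_⟩
  · apply le_antisymm
    · apply le_generateFrom
      rintro s (⟨U, hU, rfl⟩ | ⟨U, hU, rfl⟩)
      · exact hU
      · exact hU
    · conv_rhs => rw [hO]
      apply generateFrom_anti
      rintro s (⟨U, hU, rfl⟩ | ⟨U, hU, rfl⟩)
      · exact Or.inr ⟨U, hPP hU, rfl⟩
      · exact Or.inl ⟨U, hPB hU, rfl⟩
  · exact (key _ hPB hB).trans (key _ hPP hPo).symm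
  · exact key _ (fun U hU => Or.inl (hPB hU)) (fun A hA => hA.elim (hB A) (hPo A))
  · have sep : ∀ F G : M, ¬ ((F : Set X) ⊆ (G : Set X)) → ∃ u v : Set M,
        IsOpen[O] u ∧ IsOpen[O] v ∧ F ∈ u ∧ G ∈ v ∧ Disjoint u v := by
      intro F G h
      obtain ⟨x, hxF, hxG⟩ := Set.not_subset.1 h
      obtain ⟨U, hU, hGU⟩ := hMP G.2
      have hxU : x ∈ U := by
        by_contra hx
        exact hxG (by rw [hGU]; exact hx)
      obtain ⟨V, hV, W, hW, hxV, hVW, hWU⟩ := hreg x U hU hxU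
      refine ⟨hyperMinus M V, hyperPlus M W, hPP hV, hPB hW, ⟨x, hxF, hxV⟩, ?_, ?_⟩
      · intro y hy
        by_contra hyW
        rw [hGU] at hy
        exact hy (hWU hyW)
      · rw [Set.disjoint_left]
        rintro H ⟨y, hyH, hyV⟩ hH
        exact hVW hyV (hH hyH)
    refine @T2Space.mk M O ?_
    intro F G hne
    by_cases h : (F : Set X) ⊆ (G : Set X)
    · have h' : ¬ ((G : Set X) ⊆ (F : Set X)) := fun h' =>
        hne (Subtype.ext (h.antisymm h'))
      obtain ⟨u, v, hu, hv, hG, hF, hd⟩ := sep G F h'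
      exact ⟨v, u, hv, hu, hF, hG, hd.symm⟩
    · exact sep F G h
end

section
/- Let (X,T) be a topological space, M ⊆ P'(X), P be a base for T that is closed under finite intersections (P = P^∩), M = {X∖U : U ∈ P}, and let M be a natural family in X. Let O be the topology on M having as a subbase the family {U⁻_M : U ∈ P} ∪ {U⁺_M : U ∈ P}. If (M,O) is a Hausdorff space, then X is P-regular. -/
open Set TopologicalSpace Topology Cardinal

universe u

variable {X : Type u}

theorem auxA (M P : Set (Set X)) (hcap : ∀ U ∈ P, ∀ V ∈ P, U ∩ V ∈ P) (S : Set M)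
    (hS : GenerateOpen (hyperMinus M '' P ∪ hyperPlus M '' P) S) :
    ∀ F : M, F ∈ S → ∃ W : Set X, (W ∈ P ∨ W = Set.univ) ∧ (F : Set X) ⊆ W ∧
      ∀ y ∈ W, ∀ E : M, (E : Set X) = insert y (F : Set X) → E ∈ S := by
  induction hS with
  | basic S h =>
    intro F hF
    rcases h with ⟨A, hA, rfl⟩ | ⟨A, hA, rfl⟩
    · refine ⟨Set.univ, Or.inr rfl, subset_univ _, ?_⟩
      intro y _ E hE
      obtain ⟨z, hz, hzA⟩ := hF
      exact ⟨z, by rw [hE]; exact Or.inr hz, hzA⟩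
    · refine ⟨A, Or.inl hA, hF, ?_⟩
      intro y hy E hE
      change (E : Set X) ⊆ A
      rw [hE]
      exact insert_subset hy hF
  | univ => exact fun F _ => ⟨Set.univ, Or.inr rfl, subset_univ _, fun _ _ _ _ => trivial⟩
  | inter S T _ _ ihS ihT =>
    intro F hF
    obtain ⟨W, hW, hFW, h⟩ := ihS F hF.1
    obtain ⟨W', hW', hFW', h'⟩ := ihT F hF.2
    refine ⟨W ∩ W', ?_, subset_inter hFW hFW',
      fun y hy E hE => ⟨h y hy.1 E hE, h' y hy.2 E hE⟩⟩
    rcases hW with hW | rfl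
    · rcases hW' with hW' | rfl
      · exact Or.inl (hcap _ hW _ hW')
      · exact Or.inl (by simpa using hW)
    · simpa using hW'
  | sUnion C _ ih =>
    rintro F ⟨S, hSC, hFS⟩
    obtain ⟨W, hW, hFW, h⟩ := ih S hSC F hFS
    exact ⟨W, hW, hFW, fun y hy E hE => ⟨S, hSC, h y hy E hE⟩⟩

theorem auxB (M P : Set (Set X)) (hcap : ∀ U ∈ P, ∀ V ∈ P, U ∩ V ∈ P)
    (F : Set X) (x : X) (U : Set X) (hU : U ∈ P) (hx : x ∈ U)
    (G : M) (hG : (G : Set X) = insert x F) (S : Set M)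
    (hS : GenerateOpen (hyperMinus M '' P ∪ hyperPlus M '' P) S) :
    G ∈ S → ∃ V ∈ P, x ∈ V ∧ ∀ y ∈ V, ∀ E : M, (E : Set X) = insert y F → E ∈ S := by
  induction hS with
  | basic S h =>
    intro hF
    rcases h with ⟨A, hA, rfl⟩ | ⟨A, hA, rfl⟩
    · obtain ⟨z, hz, hzA⟩ := hF
      rw [hG] at hz
      rcases hz with rfl | hz
      · exact ⟨A, hA, hzA, fun y hy E hE => ⟨y, by rw [hE]; exact Or.inl rfl, hy⟩⟩
      · exact ⟨U, hU, hx, fun y hy E hE => ⟨z, by rw [hE]; exact Or.inr hz, hzA⟩⟩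
    · change (G : Set X) ⊆ A at hF
      rw [hG, insert_subset_iff] at hF
      refine ⟨A, hA, hF.1, ?_⟩
      intro y hy E hE
      change (E : Set X) ⊆ A
      rw [hE]
      exact insert_subset hy hF.2
  | univ => exact fun _ => ⟨U, hU, hx, fun _ _ _ _ => trivial⟩
  | inter S T _ _ ihS ihT =>
    intro hF
    obtain ⟨W, hW, hFW, h⟩ := ihS hF.1
    obtain ⟨W', hW', hFW', h'⟩ := ihT hF.2
    exact ⟨W ∩ W', hcap _ hW _ hW', ⟨hFW, hFW'⟩,
      fun y hy E hE => ⟨h y hy.1 E hE, h' y hy.2 E hE⟩⟩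
  | sUnion C _ ih =>
    rintro ⟨S, hSC, hFS⟩
    obtain ⟨W, hW, hFW, h⟩ := ih S hSC hFS
    exact ⟨W, hW, hFW, fun y hy E hE => ⟨S, hSC, h y hy E hE⟩⟩

/-- let `P` be a base for `(X,T)` closed under finite intersections
(`P = P^∩`), `M = {X∖U : U ∈ P}` a natural family in `X` with `M ⊆ P'(X)`, and let `O`
be the topology on `M` with subbase `{U⁻_M : U ∈ P} ∪ {U⁺_M : U ∈ P}`.  If `(M,O)` is
Hausdorff, then `X` is `P`-regular. -/
theorem statement17 [T : TopologicalSpace X]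
    (M : Set (Set X)) (hM : ∀ A ∈ M, A.Nonempty)
    (P : Set (Set X)) (hbase : IsTopologicalBasis P)
    (hcap : ∀ U ∈ P, ∀ V ∈ P, U ∩ V ∈ P)
    (hMP : M = {B | ∃ U ∈ P, B = Uᶜ})
    (hnat : ∀ x : X, {x} ∈ M)
    (hT2 : @T2Space M (generateFrom (hyperMinus M '' P ∪ hyperPlus M '' P))) :
    PRegular P := by
  intro x U hU hx
  have hF : Uᶜ ∈ M := by rw [hMP]; exact ⟨U, hU, rfl⟩
  have hins : ∀ y, insert y Uᶜ ∈ M := by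
    intro y
    have h1 := hnat y
    rw [hMP] at h1 ⊢
    obtain ⟨A, hA, hyA⟩ := h1
    refine ⟨A ∩ U, hcap _ hA _ hU, ?_⟩
    rw [compl_inter, ← hyA]
    rfl
  have hne : (⟨Uᶜ, hF⟩ : M) ≠ ⟨insert x Uᶜ, hins x⟩ := by
    intro h
    have h2 : Uᶜ = insert x Uᶜ := congrArg Subtype.val h
    have h3 : x ∈ Uᶜ := by rw [h2]; exact Or.inl rfl
    exact h3 hx
  obtain ⟨S, S', hS, hS', hFS, hGS, hd⟩ := hT2.t2 hne
  obtain ⟨W, hW, hFW, h⟩ := auxA M P hcap S hS _ hFS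
  obtain ⟨V, hV, hxV, h'⟩ := auxB M P hcap Uᶜ x U hU hx _ rfl S' hS' hGS
  have hVW : ∀ y ∈ V, y ∉ W := fun y hy hyW =>
    disjoint_left.mp hd (h y hyW ⟨_, hins y⟩ rfl) (h' y hy ⟨_, hins y⟩ rfl)
  rcases hW with hW | rfl
  · exact ⟨V, hV, W, hW, hxV, hVW, compl_subset_comm.mp hFW⟩
  · exact absurd trivial (hVW x hxV)
end

section
/- Let (X,T) be a T1-space. Then (X,T) is a T3-space (i.e., regular and T1) if and only if (CL(X),V_X) is a Hausdorff space. -/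
open Set TopologicalSpace Topology Cardinal

universe u

variable {X : Type u}

/-- Separation of two closed sets differing at a point. -/
theorem vietoris_sep_aux [TopologicalSpace X] [RegularSpace X] (F G : CLset X) (x : X)
    (hF : x ∈ (F : Set X)) (hG : x ∉ (G : Set X)) :
    ∃ u v : Set (CLset X), IsOpen[vietoris X] u ∧ IsOpen[vietoris X] v ∧
      F ∈ u ∧ G ∈ v ∧ Disjoint u v := by
  have hd := RegularSpace.regular G.2.1 hG
  obtain ⟨V, ⟨hVo, hGV⟩, U, ⟨hxU, hUo⟩, hVU⟩ :=
    ((hasBasis_nhdsSet (G : Set X)).disjoint_iff (nhds_basis_opens x)).1 hd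
  refine ⟨hyperMinus _ U, hyperPlus _ V, ?_, ?_, ⟨x, hF, hxU⟩, hGV, ?_⟩
  · exact isOpen_generateFrom_of_mem (Or.inr ⟨U, hUo, rfl⟩)
  · exact isOpen_generateFrom_of_mem (Or.inl ⟨V, hVo, rfl⟩)
  · rw [Set.disjoint_left]
    rintro H ⟨y, hyH, hyU⟩ hHV
    exact Set.disjoint_left.1 hVU (hHV hyH) hyU

/-- Adding a point to a fixed closed set is continuous into the Vietoris hyperspace. -/
theorem vietoris_insert_continuous [TopologicalSpace X] (F : Set X)
    (h : ∀ y : X, insert y F ∈ CLset X) :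
    @Continuous X (CLset X) _ (vietoris X) (fun y => ⟨insert y F, h y⟩) := by
  refine continuous_generateFrom_iff.2 ?_
  rintro _ (⟨U, hU, rfl⟩ | ⟨U, hU, rfl⟩)
  · by_cases hF : F ⊆ U
    · convert (show IsOpen U from hU) using 1
      ext y
      simp [hyperPlus, Set.insert_subset_iff, hF]
    · convert isOpen_empty using 1
      ext y
      simp [hyperPlus, Set.insert_subset_iff, hF]
  · by_cases hF : (F ∩ U).Nonempty
    · convert isOpen_univ using 1
      ext y
      simp only [hyperMinus, mem_preimage, mem_ofPred_eq, mem_univ, iff_true]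
      exact hF.mono (inter_subset_inter_left _ (subset_insert _ _))
    · convert (show IsOpen U from hU) using 1
      ext y
      simp only [hyperMinus, mem_preimage, mem_ofPred_eq]
      constructor
      · rintro ⟨z, rfl | hz, hzU⟩
        · exact hzU
        · exact (hF ⟨z, hz, hzU⟩).elim
      · intro hy
        exact ⟨y, mem_insert _ _, hy⟩

/-- a `T1`-space `X` is a `T3`-space (regular and `T1`) iff
`(CL(X), V_X)` is Hausdorff. -/
theorem statement18 [T : TopologicalSpace X] [T1Space X] :
    RegularSpace X ↔ @T2Space (CLset X) (vietoris X) := by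
  constructor
  · intro hR
    refine @T2Space.mk _ (vietoris X) ?_
    intro F G hFG
    by_cases h : (F : Set X) ⊆ G
    · have h' : ¬ (G : Set X) ⊆ F := fun h' => hFG (Subtype.ext (h.antisymm h'))
      obtain ⟨x, hG, hF⟩ := Set.not_subset.1 h'
      obtain ⟨u, v, hu, hv, h1, h2, h3⟩ := vietoris_sep_aux G F x hG hF
      exact ⟨v, u, hv, hu, h2, h1, h3.symm⟩
    · obtain ⟨x, hF, hG⟩ := Set.not_subset.1 h
      exact vietoris_sep_aux F G x hF hG
  · intro hT
    refine ⟨?_⟩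
    intro F x hF hx
    rcases F.eq_empty_or_nonempty with rfl | hne
    · simp
    have hc : ∀ y : X, insert y F ∈ CLset X := fun y =>
      ⟨by rw [Set.insert_eq]; exact isClosed_singleton.union hF, Set.insert_nonempty _ _⟩
    have hφ := vietoris_insert_continuous F hc
    have hneq : (⟨F, hF, hne⟩ : CLset X) ≠ ⟨insert x F, hc x⟩ := by
      intro h
      apply hx
      rw [show F = insert x F from congrArg Subtype.val h]
      exact mem_insert _ _
    obtain ⟨u, v, hu, hv, h1, h2, h3⟩ := @T2Space.t2 _ (vietoris X) hT _ _ hneq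
    refine ((hasBasis_nhdsSet F).disjoint_iff (nhds_basis_opens x)).2
      ⟨_, ⟨@IsOpen.preimage _ _ _ (vietoris X) _ hφ _ hu, ?_⟩,
       _, ⟨?_, @IsOpen.preimage _ _ _ (vietoris X) _ hφ _ hv⟩, h3.preimage _⟩
    · intro y hy
      have : (⟨insert y F, hc y⟩ : CLset X) = ⟨F, hF, hne⟩ :=
        Subtype.ext (Set.insert_eq_of_mem hy)
      simpa only [mem_preimage, this] using h1
    · exact h2
end

section
/- Let (X,T) be a compact T1-space, and let O be a Vietoris-type topology on CL(X,T) with T_O = T. Then (CL(X,T),O) is a compact space. -/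
open Set TopologicalSpace Topology Cardinal

universe u

variable {X : Type u}

theorem IsCompact.elim_finite_subcover_sUnion' {Y : Type*} [TopologicalSpace Y] {K : Set Y}
    (hK : IsCompact K) {J : Set (Set Y)} (hJ : ∀ C ∈ J, IsOpen C) (h : K ⊆ ⋃₀ J) :
    ∃ t ⊆ J, t.Finite ∧ K ⊆ ⋃₀ t := by
  rw [sUnion_eq_biUnion] at h
  obtain ⟨t, h1, h2, h3⟩ := hK.elim_finite_subcover_image (c := fun C => C) hJ h
  exact ⟨t, h1, h2, by rwa [sUnion_eq_biUnion]⟩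

/-- if `(X,T)` is a compact `T1`-space and `O` is a Vietoris-type
topology on `CL(X,T)` with `T_O = T`, then `(CL(X,T),O)` is compact. -/
theorem statement19 [T : TopologicalSpace X] [T1Space X] [CompactSpace X]
    (O : TopologicalSpace (CLset X)) (hV : IsVietorisType (CLset X) O)
    (hTO : TofO (CLset X) O = T) :
    @CompactSpace (CLset X) O := by
  have hopen : ∀ A ∈ BOfam (CLset X) O ∪ POfam (CLset X) O, IsOpen A := by
    intro A hA
    rw [← hTO]
    exact isOpen_generateFrom_of_mem hA
  refine @compactSpace_generateFrom _ O _ hV ?_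
  intro P hP hcov
  -- the union of the members of the lower part of the cover
  let J : Set (Set X) := {C | C ∈ POfam (CLset X) O ∧ hyperMinus (CLset X) C ∈ P}
  have hJ : ∀ C ∈ J, IsOpen C := fun C hC => hopen C (Or.inr hC.1)
  have hU : IsOpen (⋃₀ J) := isOpen_sUnion hJ
  by_cases hne : (⋃₀ J)ᶜ.Nonempty
  · have hmem : (⟨(⋃₀ J)ᶜ, hU.isClosed_compl, hne⟩ : CLset X) ∈ ⋃₀ P := by
      rw [hcov]; trivial
    obtain ⟨S, hSP, hS⟩ := hmem
    rcases hP hSP with ⟨A, hA, rfl⟩ | ⟨C, hC, rfl⟩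
    · have hS' : (⋃₀ J)ᶜ ⊆ A := hS
      have hAo : IsOpen A := hopen A (Or.inl hA)
      obtain ⟨t, htJ, htf, ht⟩ := hAo.isClosed_compl.isCompact.elim_finite_subcover_sUnion' hJ
        (compl_subset_comm.1 hS')
      refine ⟨insert (hyperPlus _ A) (hyperMinus _ '' t), ?_, (htf.image _).insert _, ?_⟩
      · rintro _ (rfl | ⟨C, hC, rfl⟩)
        · exact hSP
        · exact (htJ hC).2
      · refine eq_univ_of_forall fun G => ?_
        by_cases hG : (G : Set X) ⊆ A
        · exact ⟨_, mem_insert _ _, hG⟩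
        · obtain ⟨x, hxG, hxA⟩ := not_subset.1 hG
          obtain ⟨C, hC, hxC⟩ := ht hxA
          exact ⟨_, mem_insert_of_mem _ ⟨C, hC, rfl⟩, x, hxG, hxC⟩
    · obtain ⟨x, hx, hxC⟩ := hS
      exact absurd ⟨C, ⟨hC, hSP⟩, hxC⟩ hx
  · rw [not_nonempty_iff_eq_empty, compl_empty_iff] at hne
    obtain ⟨t, htJ, htf, ht⟩ := (isCompact_univ (X := X)).elim_finite_subcover_sUnion' hJ hne.ge
    refine ⟨hyperMinus _ '' t, ?_, htf.image _, ?_⟩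
    · rintro _ ⟨C, hC, rfl⟩
      exact (htJ hC).2
    · refine eq_univ_of_forall fun G => ?_
      obtain ⟨x, hxG⟩ := G.2.2
      obtain ⟨C, hC, hxC⟩ := ht (mem_univ x)
      exact ⟨_, ⟨C, hC, rfl⟩, x, hxG, hxC⟩
end
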